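/- Let λ > 0 be a real number. For every n ∈ ℕ and all real x, y, the modified degenerate Hermite-based polynomials satisfy 4^n · _H𝔅_n(x,y:λ) = ∑_{q=0}^{n} C(n,q) · _HT_{n−q}(x,y:λ) · ∑_{k=0}^{q} C(q,k) · _H𝔅_{q−k}(x,y:λ) · _H𝔈_k(2x, 14y:λ). -/

import Mathlib

open PowerSeries Finset

/-- The formal power series `e^{a t}`. -/
noncomputable def expX (a : ℝ) : PowerSeries ℝ :=
  PowerSeries.mk fun n => a ^ n / n.factorial

/-- The formal power series `e^{a t^2}`. -/
noncomputable def expX2 (a : ℝ) : PowerSeries ℝ :=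
  PowerSeries.mk fun n => if 2 ∣ n then a ^ (n / 2) / (n / 2).factorial else 0

/-- The formal power series `e^{x t + y t^2}`. -/
noncomputable def expH (x y : ℝ) : PowerSeries ℝ := expX x * expX2 y

theorem expX_eq_rescale (a : ℝ) : expX a = rescale a (PowerSeries.exp ℝ) := by
  ext n
  simp [expX, coeff_rescale, PowerSeries.coeff_exp, div_eq_mul_inv]

theorem expX_mul (a b : ℝ) : expX a * expX b = expX (a + b) := by
  simp only [expX_eq_rescale, PowerSeries.exp_mul_exp_eq_exp_add]

theorem expX2_eq_expand (a : ℝ) : expX2 a = (expX a).expand 2 two_ne_zero := by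
  ext n
  simp [expX2, expX, PowerSeries.coeff_expand]

theorem expX2_mul (a b : ℝ) : expX2 a * expX2 b = expX2 (a + b) := by
  simp only [expX2_eq_expand, ← map_mul, expX_mul]

theorem expH_mul (a b c d : ℝ) : expH a b * expH c d = expH (a + c) (b + d) := by
  simp only [expH, ← expX_mul, ← expX2_mul]
  ring

theorem rescale_expX (r a : ℝ) : rescale r (expX a) = expX (r * a) := by
  ext n
  simp only [expX, coeff_rescale, coeff_mk, mul_pow]
  ring

theorem rescale_expX2 (r a : ℝ) : rescale r (expX2 a) = expX2 (r ^ 2 * a) := by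
  ext n
  simp only [expX2, coeff_rescale, coeff_mk]
  split_ifs with h
  · obtain ⟨m, rfl⟩ := h
    rw [Nat.mul_div_cancel_left m two_pos, mul_pow, ← pow_mul]
    ring
  · simp

theorem rescale_expH (r a b : ℝ) : rescale r (expH a b) = expH (r * a) (r ^ 2 * b) := by
  simp only [expH, map_mul, rescale_expX, rescale_expX2]

theorem expX_sub_one_ne_zero {a : ℝ} (ha : a ≠ 0) : expX a - 1 ≠ 0 := by
  intro h
  have h1 := congrArg (coeff 1) h
  simp [expX, coeff_one] at h1
  exact ha h1

/-- The product of two exponential generating functions is the exponential generating function of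
the binomial convolution. -/
theorem mk_div_factorial_mul (f g : ℕ → ℝ) :
    (PowerSeries.mk fun n => f n / n.factorial) * (PowerSeries.mk fun n => g n / n.factorial) =
      PowerSeries.mk fun n =>
        (∑ k ∈ Finset.range (n + 1), (n.choose k : ℝ) * f (n - k) * g k) / n.factorial := by
  ext n
  rw [mul_comm, coeff_mul, Finset.Nat.sum_antidiagonal_eq_sum_range_succ_mk, coeff_mk,
    Finset.sum_div]
  refine Finset.sum_congr rfl fun k hk => ?_
  have hkn : k ≤ n := Nat.lt_succ_iff.mp (Finset.mem_range.mp hk)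
  simp only [coeff_mk]
  rw [Nat.cast_choose ℝ hkn]
  have := Nat.factorial_ne_zero n
  field_simp

/-- for λ > 0, `4^n _H𝔅_n(x,y:λ)
    = ∑_q C(n,q) _HT_{n-q}(x,y:λ) ∑_k C(q,k) _H𝔅_{q-k}(x,y:λ) _H𝔈_k(2x,14y:λ)`. -/
theorem modified_degenerate_bernoulli_tangent_euler_relation
    (l : ℝ) (hl : 0 < l)
    (T B E : ℕ → ℝ → ℝ → ℝ)
    (hT : ∀ x y : ℝ,
      (PowerSeries.mk fun n => T n x y / n.factorial) * (expX (2 * Real.log (1 + l) / l) + 1)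
        = 2 * expH (x * Real.log (1 + l) / l) (y * Real.log (1 + l) / l))
    (hB : ∀ x y : ℝ,
      (PowerSeries.mk fun n => B n x y / n.factorial) * (expX (Real.log (1 + l) / l) - 1)
        = PowerSeries.X * expH (x * Real.log (1 + l) / l) (y * Real.log (1 + l) / l))
    (hE : ∀ x y : ℝ,
      (PowerSeries.mk fun n => E n x y / n.factorial) * (expX (Real.log (1 + l) / l) + 1)
        = 2 * expH (x * Real.log (1 + l) / l) (y * Real.log (1 + l) / l))
    (n : ℕ) (x y : ℝ) :
    (4 : ℝ) ^ n * B n x y =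
      ∑ q ∈ Finset.range (n + 1), (n.choose q : ℝ) * T (n - q) x y *
        ∑ k ∈ Finset.range (q + 1), (q.choose k : ℝ) * B (q - k) x y * E k (2 * x) (14 * y) := by
  set c := Real.log (1 + l) / l with hc
  have hc0 : c ≠ 0 := (div_pos (Real.log_pos (by linarith)) hl).ne'
  have hT' := hT x y
  have hB' := hB x y
  have hE' := hE (2 * x) (14 * y)
  simp only [mul_div_assoc, ← hc] at hT' hB' hE'
  have hB4 := congrArg (rescale (4 : ℝ)) hB'
  simp only [map_mul, map_sub, map_one, rescale_expX, rescale_expH, rescale_X, rescale_mk] at hB4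
  have hden : expX (4 * c) - 1 = (expX (2 * c) + 1) * ((expX c - 1) * (expX c + 1)) := by
    have h2 : expX c * expX c = expX (2 * c) := by rw [expX_mul]; ring_nf
    have h4 : expX (2 * c) * expX (2 * c) = expX (4 * c) := by rw [expX_mul]; ring_nf
    linear_combination -h4 - (expX (2 * c) + 1) * h2
  have hnum : expH (x * c) (y * c) * (expH (x * c) (y * c) * expH (2 * x * c) (14 * y * c)) =
      expH (4 * (x * c)) (4 ^ 2 * (y * c)) := by
    rw [expH_mul, expH_mul]
    ring_nf
  have hC : (PowerSeries.C (4 : ℝ) : PowerSeries ℝ) = 4 := map_ofNat _ 4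
  have key : (PowerSeries.mk fun n => (4 : ℝ) ^ n * (B n x y / n.factorial)) =
      (PowerSeries.mk fun n => T n x y / n.factorial) *
        ((PowerSeries.mk fun n => B n x y / n.factorial) *
          (PowerSeries.mk fun n => E n (2 * x) (14 * y) / n.factorial)) := by
    refine mul_right_cancel₀ (expX_sub_one_ne_zero (mul_ne_zero four_ne_zero hc0)) ?_
    rw [hB4, hden, mul_mul_mul_comm, mul_mul_mul_comm (PowerSeries.mk fun n => B n x y / _),
      hT', hB', hE', hC, ← hnum]
    ring
  rw [mk_div_factorial_mul, mk_div_factorial_mul] at key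
  have hn := congrArg (coeff n) key
  rw [coeff_mk, coeff_mk, ← mul_div_assoc] at hn
  exact (div_left_inj' (Nat.cast_ne_zero.mpr n.factorial_ne_zero)).mp hn
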